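/- Let M be a (2n+s)-dimensional trans-S-manifold with characteristic functions α_i, β_i, fundamental 2-form F and codifferential δ. Then (δF)(X) = 2n Σ_{j=1}^s α_j η_j(X) for every vector field X on M. -/

import Mathlib

open scoped BigOperators

noncomputable section

/-- An abstract model of the algebra of smooth real-valued functions `C` of a
manifold together with its Lie algebra `V` of smooth vector fields: each vector
field acts on functions as a derivation, compatibly with the module structure
and the Lie bracket. -/
structure DiffModel (C V : Type) [CommRing C] [Algebra ℝ C]
    [LieRing V] [Module C V] where
  act : V → C → C
  act_add_left : ∀ (X Y : V) (a : C), act (X + Y) a = act X a + act Y a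
  act_smul_left : ∀ (c : C) (X : V) (a : C), act (c • X) a = c * act X a
  act_add : ∀ (X : V) (a b : C), act X (a + b) = act X a + act X b
  act_mul : ∀ (X : V) (a b : C), act X (a * b) = act X a * b + a * act X b
  act_const : ∀ (X : V) (r : ℝ), act X ((algebraMap ℝ C) r) = 0
  act_bracket : ∀ (X Y : V) (a : C),
    act ⁅X, Y⁆ a = act X (act Y a) - act Y (act X a)
  bracket_smul_right : ∀ (X : V) (c : C) (Y : V),
    ⁅X, c • Y⁆ = act X c • Y + c • ⁅X, Y⁆

/-- A Riemannian metric together with its Levi-Civita connection on the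
abstract model `D` of the vector fields of a manifold. -/
structure RiemStr {C V : Type} [CommRing C] [Algebra ℝ C]
    [LieRing V] [Module C V] (D : DiffModel C V) where
  g : V → V → C
  conn : V → V → V
  g_symm : ∀ X Y, g X Y = g Y X
  g_add_left : ∀ X Y Z, g (X + Y) Z = g X Z + g Y Z
  g_smul_left : ∀ (c : C) (X Y : V), g (c • X) Y = c * g X Y
  conn_add_left : ∀ X Y Z, conn (X + Y) Z = conn X Z + conn Y Z
  conn_smul_left : ∀ (c : C) (X Y : V), conn (c • X) Y = c • conn X Y
  conn_add_right : ∀ X Y Z, conn X (Y + Z) = conn X Y + conn X Z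
  conn_smul_right : ∀ (X : V) (c : C) (Y : V),
    conn X (c • Y) = D.act X c • Y + c • conn X Y
  torsion_free : ∀ X Y, conn X Y - conn Y X = ⁅X, Y⁆
  metric_compat : ∀ X Y Z, D.act X (g Y Z) = g (conn X Y) Z + g Y (conn X Z)

/-- An `f`-structure with `s` structure vector fields `ξ i` and dual `1`-forms
`η i` on the abstract model of the vector fields of a manifold:
`f` is a `(1,1)`-tensor field with `f ∘ f ∘ f + f = 0`, `f (ξ i) = 0`,
`η i ∘ f = 0`, `η i (ξ j) = δ i j` and `f² = -id + Σ η i ⊗ ξ i`. -/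
structure FStr (C V : Type) [CommRing C] [Algebra ℝ C]
    [LieRing V] [Module C V] (s : ℕ) where
  f : V → V
  ξ : Fin s → V
  η : Fin s → V → C
  f_add : ∀ X Y, f (X + Y) = f X + f Y
  f_smul : ∀ (c : C) (X : V), f (c • X) = c • f X
  η_add : ∀ i X Y, η i (X + Y) = η i X + η i Y
  η_smul : ∀ i (c : C) (X : V), η i (c • X) = c * η i X
  f_cube : ∀ X, f (f (f X)) + f X = 0
  f_ξ : ∀ i, f (ξ i) = 0
  η_f : ∀ i X, η i (f X) = 0
  η_ξ : ∀ i j, η i (ξ j) = if i = j then (1 : C) else 0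
  f_sq : ∀ X, f (f X) = -X + ∑ i, η i X • ξ i

section Defs

variable {C V : Type} [CommRing C] [Algebra ℝ C] [LieRing V] [Module C V] {s : ℕ}

/-- The compatibility of the metric with the `f`-structure:
`g(X,Y) = g(fX,fY) + Σ η i (X) η i (Y)`.  A metric `f`-manifold is the data of
`D`, `R`, `S` satisfying `MetricCompat D R S`. -/
def MetricCompat (D : DiffModel C V) (R : RiemStr D) (S : FStr C V s) : Prop :=
  ∀ X Y, R.g X Y = R.g (S.f X) (S.f Y) + ∑ i, S.η i X * S.η i Y

/-- The covariant derivative `(∇_X f) Y` of the tensor field `f`. -/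
def nablaF (D : DiffModel C V) (R : RiemStr D) (S : FStr C V s) (X Y : V) : V :=
  R.conn X (S.f Y) - S.f (R.conn X Y)

/-- The Nijenhuis tensor `[f,f]` of `f`. -/
def nijenhuis (S : FStr C V s) (X Y : V) : V :=
  S.f (S.f ⁅X, Y⁆) + ⁅S.f X, S.f Y⁆ - S.f ⁅S.f X, Y⁆ - S.f ⁅X, S.f Y⁆

/-- The exterior differential of a `1`-form,
`dθ(X,Y) = ½ (X θ(Y) - Y θ(X) - θ([X,Y]))`. -/
def dOne (D : DiffModel C V) (θ : V → C) (X Y : V) : C :=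
  algebraMap ℝ C (1 / 2) * (D.act X (θ Y) - D.act Y (θ X) - θ ⁅X, Y⁆)

/-- The exterior differential of a `2`-form. -/
def dTwo (D : DiffModel C V) (ω : V → V → C) (X Y Z : V) : C :=
  D.act X (ω Y Z) - D.act Y (ω X Z) + D.act Z (ω X Y)
    - ω ⁅X, Y⁆ Z + ω ⁅X, Z⁆ Y - ω ⁅Y, Z⁆ X

/-- The fundamental `2`-form `F(X,Y) = g(X, fY)` of a metric `f`-manifold. -/
def Fform (D : DiffModel C V) (R : RiemStr D) (S : FStr C V s) (X Y : V) : C :=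
  R.g X (S.f Y)

/-- Normality of an `f`-structure: `[f,f] + 2 Σ dη i ⊗ ξ i = 0`. -/
def IsNormal (D : DiffModel C V) (S : FStr C V s) : Prop :=
  ∀ X Y, nijenhuis S X Y + (2 : C) • ∑ i, dOne D (S.η i) X Y • S.ξ i = 0

/-- The almost trans-`S` condition with characteristic functions `α i`, `β i`:
`(∇_X f)Y = Σ [α i {g(fX,fY) ξ i + η i (Y) f²X} + β i {g(fX,Y) ξ i − η i (Y) fX}]`. -/
def IsAlmostTransS (D : DiffModel C V) (R : RiemStr D) (S : FStr C V s)
    (α β : Fin s → C) : Prop :=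
  ∀ X Y, nablaF D R S X Y =
    ∑ i, (α i • (R.g (S.f X) (S.f Y) • S.ξ i + S.η i Y • S.f (S.f X))
        + β i • (R.g (S.f X) Y • S.ξ i - S.η i Y • S.f X))

/-- A trans-`S`-manifold is a normal almost trans-`S`-manifold. -/
def IsTransS (D : DiffModel C V) (R : RiemStr D) (S : FStr C V s)
    (α β : Fin s → C) : Prop :=
  IsAlmostTransS D R S α β ∧ IsNormal D S

/-- A `K`-manifold: normal with closed fundamental `2`-form. -/
def IsK (D : DiffModel C V) (R : RiemStr D) (S : FStr C V s) : Prop :=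
  IsNormal D S ∧ ∀ X Y Z, dTwo D (Fform D R S) X Y Z = 0

/-- An `S`-manifold: a `K`-manifold with `F = dη i` for every `i`. -/
def IsSman (D : DiffModel C V) (R : RiemStr D) (S : FStr C V s) : Prop :=
  IsK D R S ∧ ∀ i X Y, Fform D R S X Y = dOne D (S.η i) X Y

/-- A `C`-manifold: a `K`-manifold with `dη i = 0` for every `i`. -/
def IsCman (D : DiffModel C V) (R : RiemStr D) (S : FStr C V s) : Prop :=
  IsK D R S ∧ ∀ (i : Fin s) X Y, dOne D (S.η i) X Y = 0

/-- The covariant derivative `(∇_X ω)(Y,Z)` of a `2`-form. -/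
def covTwo (D : DiffModel C V) (R : RiemStr D) (ω : V → V → C) (X Y Z : V) : C :=
  D.act X (ω Y Z) - ω (R.conn X Y) Z - ω Y (R.conn X Z)

/-- The covariant derivative `(∇_X θ)(Y)` of a `1`-form. -/
def covOne (D : DiffModel C V) (R : RiemStr D) (θ : V → C) (X Y : V) : C :=
  D.act X (θ Y) - θ (R.conn X Y)

/-- A global `f`-basis `{X_1,…,X_n, fX_1,…,fX_n, ξ_1,…,ξ_s}` of a
`(2n+s)`-dimensional metric `f`-manifold. -/
structure FBasis (D : DiffModel C V) (R : RiemStr D) (S : FStr C V s)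
    (n : ℕ) where
  e : Fin n → V
  orth : ∀ k l, R.g (e k) (e l) = if k = l then (1 : C) else 0
  orth_f : ∀ k l, R.g (e k) (S.f (e l)) = 0
  horiz : ∀ i k, S.η i (e k) = 0
  span : ∀ X : V, X = ∑ k, R.g X (e k) • e k
      + ∑ k, R.g X (S.f (e k)) • S.f (e k) + ∑ i, S.η i X • S.ξ i

/-- The codifferential `δω` of a `2`-form, computed in an `f`-basis:
`(δω)(X) = -Σ_k [(∇_{X_k}ω)(X_k,X) + (∇_{fX_k}ω)(fX_k,X)] - Σ_j (∇_{ξ_j}ω)(ξ_j,X)`. -/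
def codiffTwo {n : ℕ} (D : DiffModel C V) (R : RiemStr D) (S : FStr C V s)
    (B : FBasis D R S n) (ω : V → V → C) (X : V) : C :=
  -(∑ k, (covTwo D R ω (B.e k) (B.e k) X
      + covTwo D R ω (S.f (B.e k)) (S.f (B.e k)) X))
    - ∑ j, covTwo D R ω (S.ξ j) (S.ξ j) X

/-- The codifferential `δθ` of a `1`-form, computed in an `f`-basis. -/
def codiffOne {n : ℕ} (D : DiffModel C V) (R : RiemStr D) (S : FStr C V s)
    (B : FBasis D R S n) (θ : V → C) : C :=
  -(∑ k, (covOne D R θ (B.e k) (B.e k)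
      + covOne D R θ (S.f (B.e k)) (S.f (B.e k))))
    - ∑ j, covOne D R θ (S.ξ j) (S.ξ j)

/-- The Lie derivative of the metric along `ξ`:
`(L_ξ g)(X,Y) = ξ g(X,Y) - g([ξ,X],Y) - g(X,[ξ,Y])`. -/
def lieDerivG (D : DiffModel C V) (R : RiemStr D) (ξ X Y : V) : C :=
  D.act ξ (R.g X Y) - R.g ⁅ξ, X⁆ Y - R.g X ⁅ξ, Y⁆

end Defs

section Aux

variable {C V : Type} [CommRing C] [Algebra ℝ C] [LieRing V] [Module C V] {s : ℕ}

/-- The metric as a linear form in its second argument. -/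
def gLin {D : DiffModel C V} (R : RiemStr D) (Y : V) : V →ₗ[C] C where
  toFun Z := R.g Y Z
  map_add' A B := by rw [R.g_symm, R.g_add_left, R.g_symm A, R.g_symm B]
  map_smul' c A := by rw [R.g_symm, R.g_smul_left, R.g_symm A]; rfl

theorem gLin_apply {D : DiffModel C V} (R : RiemStr D) (Y Z : V) :
    gLin R Y Z = R.g Y Z := rfl

theorem f_zero_aux (S : FStr C V s) : S.f 0 = 0 := by
  simpa using S.f_smul (0 : C) 0

theorem f_neg_aux (S : FStr C V s) (X : V) : S.f (-X) = -S.f X := by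
  simpa using S.f_smul (-1 : C) X

theorem g_xi (D : DiffModel C V) (R : RiemStr D) (S : FStr C V s)
    (hc : MetricCompat D R S) (X : V) (i : Fin s) : R.g X (S.ξ i) = S.η i X := by
  have h0 : R.g (S.f X) 0 = 0 := (gLin R (S.f X)).map_zero
  rw [hc, S.f_ξ, h0]
  simp [S.η_ξ]

theorem covTwo_F (D : DiffModel C V) (R : RiemStr D) (S : FStr C V s) (X Y Z : V) :
    covTwo D R (Fform D R S) X Y Z = gLin R Y (nablaF D R S X Z) := by
  unfold covTwo Fform nablaF
  rw [map_sub, gLin_apply, gLin_apply, R.metric_compat]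
  ring

theorem covTwo_F' (D : DiffModel C V) (R : RiemStr D) (S : FStr C V s)
    (hc : MetricCompat D R S) (α β : Fin s → C) (hM : IsAlmostTransS D R S α β)
    (X Y Z : V) :
    covTwo D R (Fform D R S) X Y Z =
      ∑ i, (α i * (R.g (S.f X) (S.f Z) * S.η i Y + S.η i Z * R.g Y (S.f (S.f X)))
        + β i * (R.g (S.f X) Z * S.η i Y - S.η i Z * R.g Y (S.f X))) := by
  rw [covTwo_F, hM, map_sum]
  refine Finset.sum_congr rfl fun i _ => ?_
  simp only [map_add, map_sub, map_smul, gLin_apply, smul_eq_mul, g_xi D R S hc]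

theorem covTwo_unit (D : DiffModel C V) (R : RiemStr D) (S : FStr C V s)
    (hc : MetricCompat D R S) (α β : Fin s → C) (hM : IsAlmostTransS D R S α β)
    (Y Z : V) (h0 : ∀ i, S.η i Y = 0) (h1 : R.g Y Y = 1) (h2 : R.g Y (S.f Y) = 0) :
    covTwo D R (Fform D R S) Y Y Z = -∑ i, α i * S.η i Z := by
  have h3 : R.g Y (S.f (S.f Y)) = -1 := by
    rw [S.f_sq, ← gLin_apply]
    simp only [h0, zero_smul, Finset.sum_const_zero, add_zero, map_neg]
    rw [gLin_apply, h1]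
  rw [covTwo_F' D R S hc α β hM, ← Finset.sum_neg_distrib]
  refine Finset.sum_congr rfl fun i _ => ?_
  rw [h0, h2, h3]
  ring

end Aux

/-- In a `(2n+s)`-dimensional trans-`S`-manifold,
`(δF)(X) = 2n Σ_j α_j η_j(X)` for every vector field `X`. -/
theorem transS_codifferential_F
    {C V : Type} [CommRing C] [Algebra ℝ C] [LieRing V] [Module C V]
    {s n : ℕ} (D : DiffModel C V) (R : RiemStr D) (S : FStr C V s)
    (hcompat : MetricCompat D R S) (B : FBasis D R S n) (α β : Fin s → C)
    (hM : IsTransS D R S α β) :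
    ∀ X : V,
      codiffTwo D R S B (Fform D R S) X
        = ((2 * n : ℕ) : C) * ∑ j, α j * S.η j X := by
  intro X
  have hA := hM.1
  have e1 : ∀ k, covTwo D R (Fform D R S) (B.e k) (B.e k) X = -∑ i, α i * S.η i X := fun k =>
    covTwo_unit D R S hcompat α β hA _ X (fun i => B.horiz i k) (by simp [B.orth])
      (B.orth_f k k)
  have e2 : ∀ k, covTwo D R (Fform D R S) (S.f (B.e k)) (S.f (B.e k)) X
      = -∑ i, α i * S.η i X := fun k => by
    refine covTwo_unit D R S hcompat α β hA _ X (fun i => S.η_f i _) ?_ ?_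
    · have h := hcompat (B.e k) (B.e k)
      simp only [B.horiz, B.orth] at h
      simpa using h.symm
    · have h := hcompat (B.e k) (S.f (B.e k))
      simp only [B.horiz, B.orth_f] at h
      simpa using h.symm
  have e3 : ∀ j, covTwo D R (Fform D R S) (S.ξ j) (S.ξ j) X = 0 := fun j => by
    rw [covTwo_F' D R S hcompat α β hA]
    refine Finset.sum_eq_zero fun i _ => ?_
    have a1 : ∀ Z, R.g 0 Z = 0 := fun Z => by
      rw [R.g_symm]; exact (gLin R Z).map_zero
    have a2 : ∀ Z, R.g Z 0 = 0 := fun Z => (gLin R Z).map_zero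
    simp [S.f_ξ, f_zero_aux, a1, a2]
  unfold codiffTwo
  simp only [e1, e2, e3]
  simp
  ring
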